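/- Let k ≥ 4 be an even integer, N ≥ 1, and let G be a subgroup of SL(2,ℤ) with Γ(N) ⊆ G. Let G^± denote the subgroup of SL(2,ℤ) generated by G and −Id. For each orbit O of the right G^±-action on Λ_N set F_O := Σ_{μ ∈ O} E_k(·, μ, N). Then the family (F_O), indexed by the finitely many G^±-orbits O in Λ_N, is linearly independent over ℂ, and its ℂ-span equals {f ∈ span_ℂ{E_k(·, λ̄, N) : λ̄ ∈ Λ_N} : f|_k γ = f for all γ ∈ G}, the space of G-invariant Eisenstein series of weight k. -/

import Mathlib

open scoped MatrixGroups
open Complex UpperHalfPlane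

noncomputable section

abbrev SL2Z := Matrix.SpecialLinearGroup (Fin 2) ℤ

/-- weight `k` slash action of `γ ∈ SL(2,ℤ)` on functions `ℍ → ℂ`. -/
def slashf (k : ℤ) (γ : SL2Z) (f : ℍ → ℂ) : ℍ → ℂ :=
  fun τ => (((γ 1 0 : ℤ) : ℂ) * (τ : ℂ) + ((γ 1 1 : ℤ) : ℂ)) ^ (-k) * f (γ • τ)

/-- normalized Eisenstein series of weight `k` on `Γ(N)` -/
def Ek (k N : ℕ) (lam : ZMod N × ZMod N) : ℍ → ℂ :=
  fun τ => (if 3 ≤ N then (1 : ℂ) else 1/2) * ∑' cd : ℤ × ℤ,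
    if Int.gcd cd.1 cd.2 = 1 ∧ (cd.1 : ZMod N) = lam.1 ∧ (cd.2 : ZMod N) = lam.2
    then ((cd.1 : ℂ) * (τ : ℂ) + (cd.2 : ℂ)) ^ (-(k : ℤ)) else 0

/-- right action of `SL(2,ℤ)` on row vectors mod `N` -/
def rmul {N : ℕ} (lam : ZMod N × ZMod N) (γ : SL2Z) : ZMod N × ZMod N :=
  (lam.1 * ((γ 0 0 : ℤ) : ZMod N) + lam.2 * ((γ 1 0 : ℤ) : ZMod N),
   lam.1 * ((γ 0 1 : ℤ) : ZMod N) + lam.2 * ((γ 1 1 : ℤ) : ZMod N))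

/-- `-Id` in `SL(2,ℤ)` -/
def negId : SL2Z := ⟨!![-1, 0; 0, -1], by norm_num [Matrix.det_fin_two_of]⟩

/-- `O` is an orbit of the right `G`-action on `Λ_N` -/
def isOrbit (N : ℕ) (G : Subgroup SL2Z) (O : Set (ZMod N × ZMod N)) : Prop :=
  ∃ lam : ZMod N × ZMod N, addOrderOf lam = N ∧ O = {μ | ∃ γ ∈ G, rmul lam γ = μ}

section RowVectors

variable {N : ℕ}

theorem rmul_one (lam : ZMod N × ZMod N) : rmul lam 1 = lam := by
  simp [rmul]

theorem rmul_mul (lam : ZMod N × ZMod N) (γ δ : SL2Z) :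
    rmul lam (γ * δ) = rmul (rmul lam γ) δ := by
  ext <;> simp [rmul, Matrix.mul_apply, Fin.sum_univ_two] <;> ring

theorem rmul_inv_rmul (lam : ZMod N × ZMod N) (γ : SL2Z) : rmul (rmul lam γ⁻¹) γ = lam := by
  rw [← rmul_mul, inv_mul_cancel, rmul_one]

theorem rmul_rmul_inv (lam : ZMod N × ZMod N) (γ : SL2Z) : rmul (rmul lam γ) γ⁻¹ = lam := by
  rw [← rmul_mul, mul_inv_cancel, rmul_one]

theorem rmul_neg (lam : ZMod N × ZMod N) (γ : SL2Z) : rmul (-lam) γ = -rmul lam γ := by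
  ext <;> simp [rmul] <;> ring

theorem rmul_negId (lam : ZMod N × ZMod N) : rmul lam negId = -lam := by
  ext <;> simp [rmul, negId]

/-- Right multiplication by `γ` as an additive automorphism of `(ℤ/Nℤ)²`. -/
def rmulEquiv (N : ℕ) (γ : SL2Z) : (ZMod N × ZMod N) ≃+ (ZMod N × ZMod N) where
  toFun lam := rmul lam γ
  invFun lam := rmul lam γ⁻¹
  left_inv lam := rmul_rmul_inv lam γ
  right_inv lam := rmul_inv_rmul lam γ
  map_add' x y := by ext <;> simp [rmul] <;> ring

theorem addOrderOf_rmul (lam : ZMod N × ZMod N) (γ : SL2Z) :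
    addOrderOf (rmul lam γ) = addOrderOf lam :=
  (rmulEquiv N γ).addOrderOf_eq lam

/-- Right multiplication by `γ` as a permutation of `ℤ²`. -/
def rowEquiv (γ : SL2Z) : ℤ × ℤ ≃ ℤ × ℤ where
  toFun v := (v.1 * γ 0 0 + v.2 * γ 1 0, v.1 * γ 0 1 + v.2 * γ 1 1)
  invFun v := (v.1 * γ 1 1 - v.2 * γ 1 0, -v.1 * γ 0 1 + v.2 * γ 0 0)
  left_inv v := by
    have h := γ.det_coe
    rw [Matrix.det_fin_two] at h
    ext
    · linear_combination v.1 * h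
    · linear_combination v.2 * h
  right_inv v := by
    have h := γ.det_coe
    rw [Matrix.det_fin_two] at h
    ext
    · linear_combination v.1 * h
    · linear_combination v.2 * h

theorem isCoprime_rowEquiv (γ : SL2Z) (v : ℤ × ℤ) :
    IsCoprime (rowEquiv γ v).1 (rowEquiv γ v).2 ↔ IsCoprime v.1 v.2 := by
  have h := γ.det_coe
  rw [Matrix.det_fin_two] at h
  constructor
  · rintro ⟨u, w, huw⟩
    refine ⟨u * γ 0 0 + w * γ 0 1, u * γ 1 0 + w * γ 1 1, ?_⟩
    refine Eq.trans ?_ huw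
    simp only [rowEquiv, Equiv.coe_fn_mk]
    ring
  · rintro ⟨u, w, huw⟩
    refine ⟨u * γ 1 1 - w * γ 0 1, -u * γ 1 0 + w * γ 0 0, ?_⟩
    simp only [rowEquiv, Equiv.coe_fn_mk]
    linear_combination huw + (u * v.1 + w * v.2) * h

/-- Elements of order `N` lift to coprime pairs of integers. -/
theorem exists_isCoprime_lift [NeZero N] (lam : ZMod N × ZMod N) (h : addOrderOf lam = N) :
    ∃ c d : ℤ, IsCoprime c d ∧ (c : ZMod N) = lam.1 ∧ (d : ZMod N) = lam.2 := by
  have hN : 0 < N := NeZero.pos N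
  obtain ⟨x, y⟩ := lam
  set a := x.val + N with ha
  have hax : (a : ZMod N) = x := by simp [ha]
  set b := y.val with hb
  have hby : (b : ZMod N) = y := by simp [hb]
  have : NeZero a := ⟨by omega⟩
  set m := Nat.gcd a N with hm
  have hcop : Nat.Coprime b m := by
    set g := Nat.gcd b m with hg
    have hgN : g ∣ N := (Nat.gcd_dvd_right b m).trans (Nat.gcd_dvd_right a N)
    have hga : g ∣ a := (Nat.gcd_dvd_right b m).trans (Nat.gcd_dvd_left a N)
    have hgb : g ∣ b := Nat.gcd_dvd_left b m
    obtain ⟨q, hq⟩ := hgN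
    have hdvd : N ∣ q := by
      conv_lhs => rw [← h]
      rw [addOrderOf_dvd_iff_nsmul_eq_zero, ← hax, ← hby]
      obtain ⟨r, hr⟩ := hga
      obtain ⟨s, hs⟩ := hgb
      ext
      · simp only [Prod.smul_mk, nsmul_eq_mul, Prod.fst_zero]
        rw [← Nat.cast_mul, ZMod.natCast_eq_zero_iff, hr]
        exact ⟨r, by rw [hq]; ring⟩
      · simp only [Prod.smul_mk, nsmul_eq_mul, Prod.snd_zero]
        rw [← Nat.cast_mul, ZMod.natCast_eq_zero_iff, hs]
        exact ⟨s, by rw [hq]; ring⟩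
    have hqpos : 0 < q := Nat.pos_of_ne_zero fun h0 => by simp [h0] at hq; omega
    have := Nat.le_of_dvd hqpos hdvd
    change g = 1
    have hgpos : g ≠ 0 := fun h0 => by simp [h0] at hq; omega
    nlinarith [Nat.one_le_iff_ne_zero.2 hgpos]
  obtain ⟨u, hu⟩ := ZMod.unitsMap_surjective (Nat.gcd_dvd_left a N) (ZMod.unitOfCoprime b hcop)
  have hu' : ((u : ZMod a).val : ZMod m) = (b : ZMod m) := by
    have := congrArg Units.val hu
    simpa [ZMod.unitsMap_def] using this
  have hdvd : (m : ℤ) ∣ (u : ZMod a).val - b := by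
    rw [← ZMod.intCast_zmod_eq_zero_iff_dvd]
    simp only [Int.cast_sub, Int.cast_natCast, sub_eq_zero]
    exact hu'
  obtain ⟨q, hq⟩ := hdvd
  have hbez := Nat.gcd_eq_gcd_ab a N
  rw [← hm] at hbez
  refine ⟨a, b + N * (Nat.gcdB a N * q), ?_, by simpa using hax, by simpa using hby⟩
  have h1 : IsCoprime ((a : ℕ) : ℤ) ((u : ZMod a).val : ℤ) :=
    (Nat.isCoprime_iff_coprime.2 (ZMod.val_coe_unit_coprime u)).symm
  have h2 : (b : ℤ) + N * (Nat.gcdB a N * q) =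
      ((u : ZMod a).val : ℤ) + a * (-(Nat.gcdA a N * q)) := by
    rw [hbez] at hq
    linear_combination -hq
  rw [h2]
  exact h1.add_mul_left_right _

theorem exists_rmul_eq [NeZero N] (lam : ZMod N × ZMod N) (h : addOrderOf lam = N) :
    ∃ γ : SL2Z, rmul (0, 1) γ = lam := by
  obtain ⟨c, d, hcd, hc, hd⟩ := exists_isCoprime_lift lam h
  obtain ⟨γ, h0, h1⟩ := hcd.exists_SL2_row 1
  exact ⟨γ, by ext <;> simp [rmul, h0, h1, hc, hd]⟩

end RowVectors

section Eisenstein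

variable {k N : ℕ}

/-- The normalizing factor `ε_N`. -/
def eisFactor (N : ℕ) : ℂ := if 3 ≤ N then 1 else 1 / 2

theorem eisFactor_ne_zero (N : ℕ) : eisFactor N ≠ 0 := by
  unfold eisFactor; split_ifs <;> norm_num

open Classical in
theorem Ek_eq (k N : ℕ) (lam : ZMod N × ZMod N) (τ : ℍ) :
    Ek k N lam τ = eisFactor N * ∑' v : ℤ × ℤ,
      if IsCoprime v.1 v.2 ∧ ((v.1 : ZMod N), (v.2 : ZMod N)) = lam
      then ((v.1 : ℂ) * (τ : ℂ) + v.2) ^ (-(k : ℤ)) else 0 := by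
  simp only [Ek, eisFactor, Prod.ext_iff, Int.isCoprime_iff_gcd_eq_one]

theorem Ek_neg (hke : Even k) (lam : ZMod N × ZMod N) : Ek k N (-lam) = Ek k N lam := by
  ext τ
  rw [Ek_eq, Ek_eq, ← (Equiv.neg (ℤ × ℤ)).tsum_eq]
  congr 1
  refine tsum_congr fun v => ?_
  have h1 : ((((-v.1 : ℤ) : ZMod N), ((-v.2 : ℤ) : ZMod N)) = -lam) ↔
      ((v.1 : ZMod N), (v.2 : ZMod N)) = lam := by
    simp [Prod.ext_iff]
  have h2 : (((-v.1 : ℤ) : ℂ) * (τ : ℂ) + ((-v.2 : ℤ) : ℂ)) ^ (-(k : ℤ)) =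
      ((v.1 : ℂ) * (τ : ℂ) + v.2) ^ (-(k : ℤ)) := by
    have hk' : Even (-(k : ℤ)) := by simpa using hke
    rw [← hk'.neg_zpow]
    congr 1
    push_cast
    ring
  simp only [Equiv.neg_apply, Prod.fst_neg, Prod.snd_neg, IsCoprime.neg_neg_iff, h1, h2]

theorem slashf_Ek (lam : ZMod N × ZMod N) (γ : SL2Z) :
    slashf k γ (Ek k N lam) = Ek k N (rmul lam γ) := by
  ext τ
  rw [slashf, Ek_eq, Ek_eq, mul_left_comm, ← tsum_mul_left]
  congr 1
  refine Eq.trans (tsum_congr fun v => ?_) ((rowEquiv γ).tsum_eq _)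
  have h1 : (((((rowEquiv γ) v).1 : ZMod N), (((rowEquiv γ) v).2 : ZMod N)) = rmul lam γ) ↔
      ((v.1 : ZMod N), (v.2 : ZMod N)) = lam := by
    refine Iff.trans ?_ (rmulEquiv N γ).injective.eq_iff
    simp [rowEquiv, rmulEquiv, rmul]
  simp only [isCoprime_rowEquiv, h1, mul_ite, mul_zero]
  congr 1
  have hden : ((γ 1 0 : ℤ) : ℂ) * (τ : ℂ) + ((γ 1 1 : ℤ) : ℂ) ≠ 0 := by
    simpa [denom] using denom_ne_zero γ τ
  rw [coe_specialLinearGroup_apply, ← mul_zpow]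
  congr 1
  simp only [rowEquiv, Equiv.coe_fn_mk, algebraMap_int_eq, eq_intCast, Complex.ofReal_intCast]
  push_cast
  field_simp
  ring

open Filter Topology

/-- The point `(n + 1) * I` of the upper half-plane. -/
def vertPt (n : ℕ) : ℍ := ⟨⟨0, n + 1⟩, by positivity⟩

theorem tendsto_zpow_vertPt (hk : k ≠ 0) {c : ℤ} (hc : c ≠ 0) (d : ℤ) :
    Tendsto (fun n => ((c : ℂ) * (vertPt n : ℂ) + d) ^ (-(k : ℤ))) atTop (𝓝 0) := by
  rw [tendsto_zero_iff_norm_tendsto_zero]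
  have hnorm : Tendsto (fun n => ‖(c : ℂ) * (vertPt n : ℂ) + d‖) atTop atTop := by
    refine tendsto_atTop_mono (fun n => ?_) tendsto_natCast_atTop_atTop
    refine le_trans ?_ (Complex.abs_im_le_norm _)
    have h1 : (1 : ℝ) ≤ |(c : ℝ)| := by exact_mod_cast Int.one_le_abs hc
    have h2 : ((c : ℂ) * (vertPt n : ℂ) + d).im = c * (n + 1) := by
      simp [vertPt]
    rw [h2, abs_mul, abs_of_pos (by positivity : (0 : ℝ) < n + 1)]
    nlinarith [(Nat.cast_nonneg n : (0 : ℝ) ≤ n)]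
  simp only [zpow_neg, zpow_natCast, norm_inv, norm_pow]
  exact ((tendsto_pow_atTop hk).comp hnorm).inv_tendsto_atTop

open EisensteinSeries in
theorem norm_zpow_vertPt_le (n : ℕ) (v : ℤ × ℤ) :
    ‖((v.1 : ℂ) * (vertPt n : ℂ) + v.2) ^ (-(k : ℤ))‖ ≤
      r (vertPt 0) ^ (-(k : ℝ)) * ‖(finTwoArrowEquiv ℤ).symm v‖ ^ (-(k : ℝ)) := by
  have hB : (0 : ℝ) < ((0 : ℕ) : ℝ) + 1 := by norm_num
  have hmem : vertPt n ∈ verticalStrip 0 (((0 : ℕ) : ℝ) + 1) := by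
    rw [mem_verticalStrip_iff]
    constructor
    · simp [vertPt, UpperHalfPlane.re]
    · simp [vertPt, UpperHalfPlane.im]
  have := summand_bound_of_mem_verticalStrip (Nat.cast_nonneg k)
    ((finTwoArrowEquiv ℤ).symm v) hB hmem
  refine le_trans (le_of_eq ?_) this
  rw [norm_zpow, ← Real.rpow_intCast]
  simp [finTwoArrowEquiv]

open Classical in
/-- The constant term of `E_k(·, λ, N)` at the cusp `∞`. -/
theorem tendsto_Ek (hk : 4 ≤ k) (hke : Even k) (lam : ZMod N × ZMod N) :
    Tendsto (fun n => Ek k N lam (vertPt n)) atTop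
      (𝓝 (eisFactor N * ((if (0, 1) = lam then 1 else 0) + if -(0, 1) = lam then 1 else 0))) := by
  simp only [Ek_eq]
  refine Tendsto.const_mul _ ?_
  set a : ℂ := if (0, 1) = lam then 1 else 0 with ha
  set b : ℂ := if -(0, 1) = lam then 1 else 0 with hb
  have hsum : HasSum (fun v : ℤ × ℤ => (if v = (0, 1) then a else 0) +
      if v = (0, -1) then b else 0) (a + b) :=
    (hasSum_ite_eq (0, 1) a).add (hasSum_ite_eq (0, -1) b)
  rw [← hsum.tsum_eq]
  refine tendsto_tsum_of_dominated_convergence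
    (bound := fun v => EisensteinSeries.r (vertPt 0) ^ (-(k : ℝ)) *
      ‖(finTwoArrowEquiv ℤ).symm v‖ ^ (-(k : ℝ))) ?_ ?_ ?_
  · refine Summable.mul_left _ ?_
    exact (EisensteinSeries.summable_one_div_norm_rpow
      (by exact_mod_cast (by omega : 2 < k))).comp_injective (finTwoArrowEquiv ℤ).symm.injective
  · rintro ⟨c, d⟩
    by_cases hc : c = 0
    · subst hc
      refine tendsto_const_nhds.congr fun n => ?_
      have hk' : Even (-(k : ℤ)) := by simpa using hke
      by_cases hd1 : d = 1
      · subst hd1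
        simp [ha, isCoprime_one_right]
      by_cases hd2 : d = -1
      · subst hd2
        simp [hb, hk'.neg_zpow, isCoprime_one_right, IsCoprime.neg_right_iff]
      have : ¬ IsUnit d := by
        rw [Int.isUnit_iff]
        tauto
      simp [hd1, hd2, isCoprime_zero_left, this]
    · simp only [Prod.mk.injEq, hc, false_and, if_false, add_zero]
      split_ifs
      · exact tendsto_zpow_vertPt (by omega) hc d
      · exact tendsto_const_nhds
  · refine Eventually.of_forall fun n v => ?_
    split_ifs
    · exact norm_zpow_vertPt_le n v
    · rw [norm_zero]
      exact mul_nonneg (Real.rpow_nonneg (EisensteinSeries.r_pos _).le _)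
        (Real.rpow_nonneg (norm_nonneg _) _)

variable [NeZero N]

/-- The linear combination of the series `E_k(·, λ, N)` with given coefficients. -/
def eisComb (k N : ℕ) [NeZero N] : (ZMod N × ZMod N → ℂ) →ₗ[ℂ] (ℍ → ℂ) :=
  Fintype.linearCombination ℂ (Ek k N)

theorem eisComb_apply (c : ZMod N × ZMod N → ℂ) (τ : ℍ) :
    eisComb k N c τ = ∑ lam, c lam * Ek k N lam τ := by
  simp [eisComb, Fintype.linearCombination_apply, Finset.sum_apply]

theorem eisComb_single (lam : ZMod N × ZMod N) :
    eisComb k N (Pi.single lam 1) = Ek k N lam := by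
  simp [eisComb]

theorem eisComb_comp_neg (hke : Even k) (c : ZMod N × ZMod N → ℂ) :
    eisComb k N (fun lam => c (-lam)) = eisComb k N c := by
  ext τ
  rw [eisComb_apply, eisComb_apply]
  refine Fintype.sum_equiv (Equiv.neg _) _ _ fun lam => ?_
  simp [Ek_neg hke]

theorem slashf_eisComb (c : ZMod N × ZMod N → ℂ) (γ : SL2Z) :
    slashf k γ (eisComb k N c) = eisComb k N (fun lam => c (rmul lam γ⁻¹)) := by
  ext τ
  rw [slashf, eisComb_apply, eisComb_apply, Finset.mul_sum]
  refine Fintype.sum_equiv (rmulEquiv N γ).toEquiv _ _ fun lam => ?_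
  have h := congrFun (slashf_Ek (k := k) lam γ) τ
  change _ = c (rmul (rmul lam γ) γ⁻¹) * Ek k N (rmul lam γ) τ
  rw [rmul_rmul_inv, ← h, slashf, mul_left_comm]

/-- An even coefficient function is determined on `Λ_N` by the corresponding linear combination
of Eisenstein series. -/
theorem eq_zero_of_eisComb_eq_zero (hk : 4 ≤ k) (hke : Even k) {c : ZMod N × ZMod N → ℂ}
    (hc : ∀ lam, c (-lam) = c lam) (h0 : eisComb k N c = 0) {lam : ZMod N × ZMod N}
    (hlam : addOrderOf lam = N) : c lam = 0 := by
  classical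
  obtain ⟨γ, rfl⟩ := exists_rmul_eq lam hlam
  have h1 : eisComb k N (fun μ => c (rmul μ γ)) = 0 := by
    have := slashf_eisComb (k := k) c γ⁻¹
    rw [inv_inv, h0] at this
    rw [← this]
    ext τ
    simp [slashf]
  have h2 : Tendsto (fun n => eisComb k N (fun μ => c (rmul μ γ)) (vertPt n)) atTop
      (𝓝 (∑ μ, c (rmul μ γ) * (eisFactor N *
        ((if (0, 1) = μ then 1 else 0) + if -(0, 1) = μ then 1 else 0)))) := by
    simp only [eisComb_apply]
    exact tendsto_finsetSum _ fun μ _ => (tendsto_Ek hk hke μ).const_mul _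
  rw [h1] at h2
  have h3 := tendsto_nhds_unique h2 (tendsto_const_nhds (x := (0 : ℂ)))
  simp only [mul_add, Finset.sum_add_distrib,
    mul_ite, mul_one, mul_zero, Finset.sum_ite_eq, Finset.mem_univ, if_true, rmul_neg, hc] at h3
  rw [← two_mul] at h3
  simpa [eisFactor_ne_zero] using h3

/-- Every element of the Eisenstein space has an even coefficient function supported on `Λ_N`. -/
theorem exists_eisComb_eq (hke : Even k) {f : ℍ → ℂ}
    (hf : f ∈ Submodule.span ℂ
      {g : ℍ → ℂ | ∃ lam : ZMod N × ZMod N, addOrderOf lam = N ∧ g = Ek k N lam}) :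
    ∃ c : ZMod N × ZMod N → ℂ, (∀ lam, c (-lam) = c lam) ∧
      (∀ lam, addOrderOf lam ≠ N → c lam = 0) ∧ eisComb k N c = f := by
  obtain ⟨c, hc, rfl⟩ : ∃ c : ZMod N × ZMod N → ℂ,
      (∀ lam, addOrderOf lam ≠ N → c lam = 0) ∧ eisComb k N c = f := by
    induction hf using Submodule.span_induction with
    | mem g hg =>
      obtain ⟨lam, hlam, rfl⟩ := hg
      refine ⟨Pi.single lam 1, fun μ hμ => Pi.single_eq_of_ne ?_ _, eisComb_single lam⟩
      rintro rfl
      exact hμ hlam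
    | zero => exact ⟨0, fun _ _ => rfl, map_zero _⟩
    | add f g _ _ hf hg =>
      obtain ⟨c, hc, rfl⟩ := hf
      obtain ⟨d, hd, rfl⟩ := hg
      exact ⟨c + d, fun μ hμ => by simp [hc μ hμ, hd μ hμ], map_add _ _ _⟩
    | smul a f _ hf =>
      obtain ⟨c, hc, rfl⟩ := hf
      exact ⟨a • c, fun μ hμ => by simp [hc μ hμ], map_smul _ _ _⟩
  refine ⟨(1 / 2 : ℂ) • (c + fun lam => c (-lam)), fun lam => ?_, fun lam hlam => ?_, ?_⟩
  · simp [add_comm]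
  · have : addOrderOf (-lam) ≠ N := by rwa [addOrderOf_neg]
    simp [hc _ hlam, hc _ this]
  · rw [map_smul, map_add, eisComb_comp_neg hke, ← two_smul ℂ, smul_smul]
    norm_num

theorem eisComb_mem_span {c : ZMod N × ZMod N → ℂ} (hc : ∀ lam, addOrderOf lam ≠ N → c lam = 0) :
    eisComb k N c ∈ Submodule.span ℂ
      {g : ℍ → ℂ | ∃ lam : ZMod N × ZMod N, addOrderOf lam = N ∧ g = Ek k N lam} := by
  rw [eisComb, Fintype.linearCombination_apply]
  refine Submodule.sum_mem _ fun lam _ => ?_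
  by_cases h : addOrderOf lam = N
  · exact Submodule.smul_mem _ _ (Submodule.subset_span ⟨lam, h, rfl⟩)
  · simp [hc lam h]

theorem tsum_Ek_eq_eisComb (O : Set (ZMod N × ZMod N)) :
    (fun τ : ℍ => ∑' μ : O, Ek k N (μ : ZMod N × ZMod N) τ) = eisComb k N (O.indicator 1) := by
  classical
  ext τ
  rw [tsum_subtype O (fun μ => Ek k N μ τ), tsum_fintype, eisComb_apply]
  refine Finset.sum_congr rfl fun μ _ => ?_
  by_cases h : μ ∈ O <;> simp [h]

end Eisenstein

section Orbits

variable {N : ℕ} {H : Subgroup SL2Z} {O O' : Set (ZMod N × ZMod N)} {lam : ZMod N × ZMod N}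

theorem isOrbit.addOrderOf_eq (hO : isOrbit N H O) (h : lam ∈ O) : addOrderOf lam = N := by
  obtain ⟨μ, hμ, rfl⟩ := hO
  obtain ⟨γ, -, rfl⟩ := h
  rw [addOrderOf_rmul, hμ]

theorem isOrbit.eq_of_mem (hO : isOrbit N H O) (h : lam ∈ O) :
    O = {μ | ∃ γ ∈ H, rmul lam γ = μ} := by
  obtain ⟨μ, hμ, rfl⟩ := hO
  obtain ⟨γ, hγ, rfl⟩ := h
  ext ν
  constructor
  · rintro ⟨δ, hδ, rfl⟩
    exact ⟨γ⁻¹ * δ, H.mul_mem (H.inv_mem hγ) hδ, by rw [rmul_mul, rmul_rmul_inv]⟩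
  · rintro ⟨δ, hδ, rfl⟩
    exact ⟨γ * δ, H.mul_mem hγ hδ, rmul_mul _ _ _⟩

theorem isOrbit.eq (hO : isOrbit N H O) (hO' : isOrbit N H O') (h : lam ∈ O) (h' : lam ∈ O') :
    O = O' :=
  (hO.eq_of_mem h).trans (hO'.eq_of_mem h').symm

theorem isOrbit.rmul_mem (hO : isOrbit N H O) {γ : SL2Z} (hγ : γ ∈ H) (h : lam ∈ O) :
    rmul lam γ ∈ O := by
  rw [hO.eq_of_mem h]
  exact ⟨γ, hγ, rfl⟩

theorem isOrbit.rmul_mem_iff (hO : isOrbit N H O) {γ : SL2Z} (hγ : γ ∈ H) :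
    rmul lam γ ∈ O ↔ lam ∈ O :=
  ⟨fun h => by simpa [rmul_rmul_inv] using hO.rmul_mem (H.inv_mem hγ) h, hO.rmul_mem hγ⟩

theorem isOrbit.indicator_rmul (hO : isOrbit N H O) {γ : SL2Z} (hγ : γ ∈ H)
    (lam : ZMod N × ZMod N) :
    O.indicator (1 : ZMod N × ZMod N → ℂ) (rmul lam γ) = O.indicator 1 lam := by
  by_cases h : lam ∈ O
  · simp [h, hO.rmul_mem hγ h]
  · simp [h, mt (hO.rmul_mem_iff hγ).1 h]

theorem isOrbit.nonempty (hO : isOrbit N H O) : O.Nonempty := by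
  obtain ⟨μ, -, rfl⟩ := hO
  exact ⟨μ, 1, H.one_mem, rmul_one μ⟩

theorem exists_isOrbit_mem (H : Subgroup SL2Z) (h : addOrderOf lam = N) :
    ∃ O, isOrbit N H O ∧ lam ∈ O :=
  ⟨_, ⟨lam, h, rfl⟩, 1, H.one_mem, rmul_one lam⟩

/-- A function that takes the value `g O` on each orbit `O` is obtained by summing indicators. -/
theorem isOrbit.sum_indicator_apply [Fintype {O // isOrbit N H O}]
    (g : {O // isOrbit N H O} → ℂ) (hO : isOrbit N H O) (h : lam ∈ O) :
    (∑ P, g P • (P : Set (ZMod N × ZMod N)).indicator (1 : ZMod N × ZMod N → ℂ)) lam =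
      g ⟨O, hO⟩ := by
  rw [Finset.sum_apply, Finset.sum_eq_single ⟨O, hO⟩]
  · simp [h]
  · intro P _ hP
    have : lam ∉ (P : Set (ZMod N × ZMod N)) := fun h' => hP (Subtype.ext (P.2.eq hO h' h))
    simp [this]
  · simp

theorem sum_indicator_eq [Fintype {O // isOrbit N H O}] {c : ZMod N × ZMod N → ℂ}
    (hinv : ∀ γ ∈ H, ∀ lam, c (rmul lam γ) = c lam)
    (hsupp : ∀ lam, addOrderOf lam ≠ N → c lam = 0) :
    ∑ P : {O // isOrbit N H O}, c P.2.nonempty.some •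
      (P : Set (ZMod N × ZMod N)).indicator (1 : ZMod N × ZMod N → ℂ) = c := by
  ext lam
  by_cases h : addOrderOf lam = N
  · obtain ⟨O, hO, hmem⟩ := exists_isOrbit_mem H h
    rw [hO.sum_indicator_apply (fun P => c P.2.nonempty.some) hmem]
    have hsome := hO.nonempty.some_mem
    obtain ⟨γ, hγ, heq⟩ := (hO.eq_of_mem hmem).subset hsome
    have : c (hO.nonempty.some) = c lam := by rw [← hinv γ hγ lam, heq]
    exact this
  · rw [hsupp lam h, Finset.sum_apply]
    refine Finset.sum_eq_zero fun P _ => ?_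
    have : lam ∉ (P : Set (ZMod N × ZMod N)) := fun h' => h (P.2.addOrderOf_eq h')
    simp [this]

theorem forall_mem_sup_negId {G : Subgroup SL2Z} {c : ZMod N × ZMod N → ℂ}
    (hG : ∀ γ ∈ G, ∀ lam, c (rmul lam γ) = c lam) (hneg : ∀ lam, c (-lam) = c lam) :
    ∀ γ ∈ G ⊔ Subgroup.closure {negId}, ∀ lam, c (rmul lam γ) = c lam := by
  let K : Subgroup SL2Z :=
    { carrier := {γ | ∀ lam, c (rmul lam γ) = c lam}
      mul_mem' := fun {a b} ha hb lam => by rw [rmul_mul, hb, ha]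
      one_mem' := fun lam => by rw [rmul_one]
      inv_mem' := fun {a} ha lam => by rw [← ha (rmul lam a⁻¹), rmul_inv_rmul] }
  have hle : G ⊔ Subgroup.closure {negId} ≤ K := by
    refine sup_le hG ((Subgroup.closure_le K).2 ?_)
    rintro _ rfl lam
    rw [rmul_negId, hneg]
  exact hle

end Orbits

/-- For even `k ≥ 4`, `N ≥ 1`, `Γ(N) ⊆ G`, the orbital sums
`F_O = Σ_{μ ∈ O} E_k(·,μ,N)` over the `G^±`-orbits `O` in `Λ_N` are linearly
independent over `ℂ` and span the space of `G`-invariant weight-`k` Eisenstein series. -/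
theorem spectral_basis_even (k N : ℕ) (hk : 4 ≤ k) (hke : Even k) [NeZero N]
    (G : Subgroup SL2Z) (hG : CongruenceSubgroup.Gamma N ≤ G) :
    LinearIndependent ℂ
      (fun O : {O : Set (ZMod N × ZMod N) //
          isOrbit N (G ⊔ Subgroup.closure {negId}) O} =>
        (fun τ : ℍ => ∑' μ : (O : Set (ZMod N × ZMod N)), Ek k N (μ : ZMod N × ZMod N) τ)) ∧
    (Submodule.span ℂ (Set.range
      (fun O : {O : Set (ZMod N × ZMod N) //
          isOrbit N (G ⊔ Subgroup.closure {negId}) O} =>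
        (fun τ : ℍ => ∑' μ : (O : Set (ZMod N × ZMod N)), Ek k N (μ : ZMod N × ZMod N) τ)))
      : Set (ℍ → ℂ)) =
      {f : ℍ → ℂ | f ∈ Submodule.span ℂ
          {g : ℍ → ℂ | ∃ lam : ZMod N × ZMod N, addOrderOf lam = N ∧ g = Ek k N lam} ∧
        ∀ γ ∈ G, slashf (k : ℤ) γ f = f} := by
  have : Finite {O : Set (ZMod N × ZMod N) // isOrbit N (G ⊔ Subgroup.closure {negId}) O} :=
    Subtype.finite
  have := Fintype.ofFinite
    {O : Set (ZMod N × ZMod N) // isOrbit N (G ⊔ Subgroup.closure {negId}) O}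
  have hneg : negId ∈ G ⊔ Subgroup.closure {negId} :=
    Subgroup.mem_sup_right (Subgroup.mem_closure_singleton_self _)
  rw [show (fun O : {O : Set (ZMod N × ZMod N) //
          isOrbit N (G ⊔ Subgroup.closure {negId}) O} =>
        (fun τ : ℍ => ∑' μ : (O : Set (ZMod N × ZMod N)), Ek k N (μ : ZMod N × ZMod N) τ)) =
      fun O : {O : Set (ZMod N × ZMod N) // isOrbit N (G ⊔ Subgroup.closure {negId}) O} =>
        eisComb k N ((O : Set (ZMod N × ZMod N)).indicator 1) from
    funext fun O => tsum_Ek_eq_eisComb _]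
  constructor
  · rw [Fintype.linearIndependent_iff]
    rintro g hg ⟨O, hO⟩
    simp only [← map_smul, ← map_sum] at hg
    obtain ⟨lam, hlam⟩ := hO.nonempty
    rw [← hO.sum_indicator_apply g hlam]
    refine eq_zero_of_eisComb_eq_zero hk hke (fun μ => ?_) hg (hO.addOrderOf_eq hlam)
    simp only [Finset.sum_apply, Pi.smul_apply]
    refine Finset.sum_congr rfl fun P _ => ?_
    rw [← rmul_negId, P.2.indicator_rmul hneg]
  · ext f
    simp only [SetLike.mem_coe, Set.mem_ofPred_eq]
    constructor
    · intro hf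
      induction hf using Submodule.span_induction with
      | mem f hf =>
        obtain ⟨⟨O, hO⟩, rfl⟩ := hf
        refine ⟨eisComb_mem_span fun lam hlam => ?_, fun γ hγ => ?_⟩
        · exact Set.indicator_of_notMem (fun h => hlam (hO.addOrderOf_eq h)) _
        · rw [slashf_eisComb]
          congr 1
          ext lam
          exact hO.indicator_rmul (Subgroup.mem_sup_left (G.inv_mem hγ)) lam
      | zero => exact ⟨Submodule.zero_mem _, fun γ _ => by ext; simp [slashf]⟩
      | add f g _ _ hf hg =>
        refine ⟨Submodule.add_mem _ hf.1 hg.1, fun γ hγ => ?_⟩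
        conv_rhs => rw [← hf.2 γ hγ, ← hg.2 γ hγ]
        ext; simp [slashf, mul_add]
      | smul a f _ hf =>
        refine ⟨Submodule.smul_mem _ a hf.1, fun γ hγ => ?_⟩
        conv_rhs => rw [← hf.2 γ hγ]
        ext; simp [slashf, mul_left_comm]
    · rintro ⟨hf, hinv⟩
      obtain ⟨c, hcneg, hsupp, rfl⟩ := exists_eisComb_eq hke hf
      have hcG : ∀ γ ∈ G, ∀ lam, c (rmul lam γ) = c lam := by
        intro γ hγ lam
        by_cases hlam : addOrderOf lam = N
        · have h0 : eisComb k N ((fun μ => c (rmul μ γ)) - c) = 0 := by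
            have h := slashf_eisComb (k := k) c γ⁻¹
            rw [hinv _ (G.inv_mem hγ), inv_inv] at h
            rw [map_sub, ← h, sub_self]
          exact sub_eq_zero.1 (eq_zero_of_eisComb_eq_zero hk hke
            (fun μ => by simp [rmul_neg, hcneg]) h0 hlam)
        · rw [hsupp lam hlam, hsupp _ (by rwa [addOrderOf_rmul])]
      rw [← sum_indicator_eq (forall_mem_sup_negId hcG hcneg) hsupp, map_sum]
      refine Submodule.sum_mem _ fun P _ => ?_
      rw [map_smul]
      exact Submodule.smul_mem _ _ (Submodule.subset_span ⟨P, rfl⟩)
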